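/- Suppose ∫_{S^{d-1}} β(w)^{α−2} λ(dw) < ∞. Then for all coordinate indices i, j ∈ {1,…,d}, the function x ↦ x_i x_j is ν-integrable and ∫_{ℝ^d} x_i x_j dν(x) = Γ(2−α) ∫_{S^{d-1}} β(w)^{α−2} w_i w_j λ(dw); that is, the second-moment matrix of ν equals Γ(2−α) ∫_{S^{d-1}} β(w)^{α−2} w w^T λ(dw). -/

import Mathlib

open MeasureTheory Set

/-- The radial measure `e^{-b r} r^{-α-1} dr` on `(0,∞)`. -/
noncomputable def radialETaS (α b : ℝ) : Measure ℝ :=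
  (volume.restrict (Set.Ioi (0:ℝ))).withDensity
    (fun r => ENNReal.ofReal (Real.exp (-b * r) * r ^ (-α - 1)))

/-- The exponential tempered `α`-stable Lévy measure on `ℝ^d` with spherical
measure `lam` and tempering function `β`:
`ν(E) = ∫_{S^{d-1}} ∫_0^∞ 1_E(r w) e^{-β(w) r} r^{-α-1} dr λ(dw)`. -/
noncomputable def etas (d : ℕ) (α : ℝ) (lam : Measure (EuclideanSpace ℝ (Fin d)))
    (β : EuclideanSpace ℝ (Fin d) → ℝ) : Measure (EuclideanSpace ℝ (Fin d)) :=
  lam.bind (fun w => (radialETaS α (β w)).map (fun r : ℝ => r • w))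

lemma lintegral_radial (α b c : ℝ) (hα : α < 2) (hb : 0 < b) :
    ∫⁻ r, ENNReal.ofReal (r ^ 2 * c) ∂(radialETaS α b)
      = ENNReal.ofReal (Real.Gamma (2 - α) * (b ^ (α - 2) * c)) := by
  unfold radialETaS
  rw [lintegral_withDensity_eq_lintegral_mul _ (by fun_prop) (by fun_prop)]
  have hI := Real.integral_rpow_mul_exp_neg_mul_Ioi (a := 2 - α) (r := b) (by linarith) hb
  have hG : 0 < Real.Gamma (2 - α) := Real.Gamma_pos_of_pos (by linarith)
  have hint : Integrable (fun t : ℝ => t ^ (2 - α - 1) * Real.exp (-(b * t)))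
      (volume.restrict (Ioi 0)) := by
    by_contra h
    rw [integral_undef h] at hI
    have : 0 < (1 / b) ^ (2 - α) * Real.Gamma (2 - α) := by positivity
    linarith
  have h1 : ∫⁻ r in Ioi (0:ℝ), ((fun r => ENNReal.ofReal (Real.exp (-b * r) * r ^ (-α - 1))) *
      fun r => ENNReal.ofReal (r ^ 2 * c)) r
      = ∫⁻ r in Ioi (0:ℝ), ENNReal.ofReal (r ^ (2 - α - 1) * Real.exp (-(b * r))) *
          ENNReal.ofReal c := by
    refine setLIntegral_congr_fun measurableSet_Ioi ?_
    intro r hr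
    have hr : 0 < r := hr
    have e : r ^ (2 - α - 1) = r ^ (-α - 1) * r ^ 2 := by
      rw [← Real.rpow_natCast r 2, ← Real.rpow_add hr]
      congr 1; push_cast; ring
    simp only [Pi.mul_apply]
    rw [← ENNReal.ofReal_mul (by positivity), ← ENNReal.ofReal_mul (by positivity), e]
    congr 1
    rw [neg_mul]; ring
  rw [h1, lintegral_mul_const _ (by fun_prop), ← ofReal_integral_eq_lintegral_ofReal hint, hI,
    ← ENNReal.ofReal_mul (by positivity)]
  · congr 1
    have : (1 / b) ^ (2 - α) = b ^ (α - 2) := by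
      rw [one_div, Real.inv_rpow hb.le, ← Real.rpow_neg hb.le]; congr 1; ring
    rw [this]; ring
  · filter_upwards [ae_restrict_mem measurableSet_Ioi] with r hr
    have hr : 0 < r := hr
    simp only [Pi.zero_apply]
    positivity

lemma measurable_etas_kernel (d : ℕ) (α : ℝ)
    (β : EuclideanSpace ℝ (Fin d) → ℝ) (hβ : Measurable β) :
    Measurable (fun w : EuclideanSpace ℝ (Fin d) =>
      (radialETaS α (β w)).map (fun r : ℝ => r • w)) := by
  refine Measure.measurable_of_measurable_coe _ fun s hs => ?_
  have : (fun w : EuclideanSpace ℝ (Fin d) =>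
      (radialETaS α (β w)).map (fun r : ℝ => r • w) s) = fun w =>
      ∫⁻ r in Ioi (0:ℝ), ENNReal.ofReal (Real.exp (-β w * r) * r ^ (-α - 1)) *
        s.indicator 1 (r • w) := by
    funext w
    rw [← lintegral_indicator_one hs,
      lintegral_map (measurable_one.indicator hs) (by fun_prop)]
    unfold radialETaS
    have hm : Measurable (fun r : ℝ => s.indicator (1 : EuclideanSpace ℝ (Fin d) → ENNReal)
        (r • w)) :=
      (measurable_one.indicator hs).comp (by fun_prop)
    rw [lintegral_withDensity_eq_lintegral_mul _ (by fun_prop) hm]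
    rfl
  rw [this]
  refine Measurable.lintegral_prod_right' (f := fun p : EuclideanSpace ℝ (Fin d) × ℝ =>
    ENNReal.ofReal (Real.exp (-β p.1 * p.2) * p.2 ^ (-α - 1)) *
        s.indicator 1 (p.2 • p.1)) ?_
  refine Measurable.mul (by fun_prop) ((measurable_one.indicator hs).comp (by fun_prop))

lemma lintegral_etas (d : ℕ) (α : ℝ) (hα : α < 2)
    (lam : Measure (EuclideanSpace ℝ (Fin d)))
    (β : EuclideanSpace ℝ (Fin d) → ℝ) (hβ : Measurable β)
    (hpos : ∀ᵐ w ∂lam, 0 < β w)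
    (g : EuclideanSpace ℝ (Fin d) → ℝ) (hg : Measurable g)
    (hhom : ∀ (r : ℝ) w, g (r • w) = r ^ 2 * g w) :
    ∫⁻ x, ENNReal.ofReal (g x) ∂(etas d α lam β)
      = ∫⁻ w, ENNReal.ofReal (Real.Gamma (2 - α) * (β w ^ (α - 2) * g w)) ∂lam := by
  unfold etas
  rw [Measure.lintegral_bind (measurable_etas_kernel d α β hβ).aemeasurable (by fun_prop)]
  refine lintegral_congr_ae ?_
  filter_upwards [hpos] with w hw
  rw [lintegral_map (by fun_prop) (by fun_prop)]
  simp only [hhom]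
  exact lintegral_radial α (β w) (g w) hα hw

/-- if `∫_{S^{d-1}} β(w)^{α−2} dλ(w) < ∞`, then for all coordinates
`i j`, `x ↦ x_i x_j` is `ν`-integrable and
`∫_{ℝ^d} x_i x_j dν(x) = Γ(2−α) ∫_{S^{d-1}} β(w)^{α−2} w_i w_j dλ(w)`. -/
theorem etas_secondMoment
    (d : ℕ) (hd : 1 ≤ d) (α : ℝ) (hα : α ∈ Set.Ioo (0:ℝ) 2)
    (lam : Measure (EuclideanSpace ℝ (Fin d))) [IsFiniteMeasure lam]
    (hlam : lam (Metric.sphere (0 : EuclideanSpace ℝ (Fin d)) 1)ᶜ = 0)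
    (β : EuclideanSpace ℝ (Fin d) → ℝ) (hβ : Measurable β)
    (hβpos : ∀ w ∈ Metric.sphere (0 : EuclideanSpace ℝ (Fin d)) 1, 0 < β w)
    (hmom : (∫⁻ w, ENNReal.ofReal (β w ^ (α - 2)) ∂lam) < ⊤) :
    ∀ i j : Fin d,
      Integrable (fun x : EuclideanSpace ℝ (Fin d) => x i * x j) (etas d α lam β) ∧
      (∫ x : EuclideanSpace ℝ (Fin d), x i * x j ∂(etas d α lam β))
        = Real.Gamma (2 - α) * ∫ w : EuclideanSpace ℝ (Fin d),
            β w ^ (α - 2) * (w i * w j) ∂lam := by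
  intro i j
  have hsph : ∀ᵐ w ∂lam, w ∈ Metric.sphere (0 : EuclideanSpace ℝ (Fin d)) 1 := hlam
  have hpos : ∀ᵐ w ∂lam, 0 < β w := hsph.mono hβpos
  have hα2 : α < 2 := hα.2
  have hG : 0 < Real.Gamma (2 - α) := Real.Gamma_pos_of_pos (by linarith)
  have key := lintegral_etas d α hα2 lam β hβ hpos
  have hF : Integrable (fun w : EuclideanSpace ℝ (Fin d) => β w ^ (α - 2)) lam := by
    refine ⟨(hβ.pow_const _).aestronglyMeasurable, ?_⟩
    rw [hasFiniteIntegral_iff_norm]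
    refine lt_of_le_of_lt (lintegral_mono_ae ?_) hmom
    filter_upwards [hpos] with w hw
    rw [Real.norm_of_nonneg (by positivity)]
  have hbd : ∀ᵐ w ∂lam, ‖w i * w j‖ ≤ 1 := by
    filter_upwards [hsph] with w hw
    have hw1 : ‖w‖ = 1 := by simpa using hw
    have h1 := PiLp.norm_apply_le w i
    have h2 := PiLp.norm_apply_le w j
    rw [hw1] at h1 h2
    rw [norm_mul]
    exact mul_le_one₀ h1 (norm_nonneg _) h2
  have hR : Integrable (fun w : EuclideanSpace ℝ (Fin d) =>
      Real.Gamma (2 - α) * (β w ^ (α - 2) * (w i * w j))) lam :=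
    (hF.mul_bdd (c := 1) (by fun_prop) hbd).const_mul _
  have k1 := key (fun x => x i * x j) (by fun_prop)
    (fun r w => by simp only [PiLp.smul_apply, smul_eq_mul]; ring)
  have k2 := key (fun x => -(x i * x j)) (by fun_prop)
    (fun r w => by simp only [PiLp.smul_apply, smul_eq_mul]; ring)
  have k3 := key (fun x => |x i * x j|) (by fun_prop)
    (fun r w => by
      simp only [PiLp.smul_apply, smul_eq_mul]
      rw [← abs_of_nonneg (sq_nonneg r), ← abs_mul]
      congr 1; ring)
  have hL : Integrable (fun x : EuclideanSpace ℝ (Fin d) => x i * x j) (etas d α lam β) := by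
    refine ⟨by fun_prop, ?_⟩
    rw [hasFiniteIntegral_iff_norm]
    simp only [Real.norm_eq_abs]
    rw [k3]
    have := hR.2
    rw [hasFiniteIntegral_iff_norm] at this
    refine lt_of_le_of_lt (lintegral_mono_ae ?_) this
    filter_upwards [hpos] with w hw
    rw [Real.norm_eq_abs, abs_mul (Real.Gamma (2 - α)), abs_of_pos hG, abs_mul (β w ^ (α - 2)),
      abs_of_nonneg (Real.rpow_nonneg hw.le _)]
  refine ⟨hL, ?_⟩
  rw [← integral_const_mul, integral_eq_lintegral_pos_part_sub_lintegral_neg_part hL,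
    integral_eq_lintegral_pos_part_sub_lintegral_neg_part hR, k1, k2]
  simp only [mul_neg]
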